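/- Peterson's formula: Let π be a dominant integral weight and let w ∈ W be a π-minuscule element. Then the number of reduced expressions of w satisfies #Red(w) = ℓ(w)! / ∏_{β ∈ S(w)} ht(β), where ht(β) is the height of the positive root β. -/

import Mathlib

open scoped Classical BigOperators

/-- A bundled setting for a finite crystallographic root system together with its
Weyl group, its action on the rational span of the weight lattice, reflections,
and the data of coefficients of roots in the basis of simple roots. -/
structure WeylSetting where
  /-- index set of the Dynkin diagram (simple roots) -/
  I : Type
  [fintypeI : Fintype I]
  [decEqI : DecidableEq I]
  /-- rational span of the weight lattice -/
  V : Type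
  [acg : AddCommGroup V]
  [mod : Module ℚ V]
  /-- the Weyl group -/
  W : Type
  [grp : Group W]
  /-- the action of the Weyl group on weights -/
  act : W →* (V ≃ₗ[ℚ] V)
  /-- the simple roots -/
  simple : I → V
  /-- the (finite) set of roots -/
  roots : Finset V
  /-- `coroot β μ` is the pairing `⟨μ, β∨⟩` -/
  coroot : V → (V →ₗ[ℚ] ℚ)
  /-- the reflection `s_β ∈ W` associated to a root `β` -/
  srefl : V → W
  /-- coefficients of a positive root in the basis of simple roots -/
  posCoeff : V → I → ℕ
  simple_mem : ∀ i, simple i ∈ roots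
  simple_indep : LinearIndependent ℚ simple
  roots_neg : ∀ β ∈ roots, -β ∈ roots
  root_pos_or_neg : ∀ β ∈ roots,
    (∃ c : I → ℚ, (∀ i, 0 ≤ c i) ∧ β = ∑ i, c i • simple i) ∨
    (∃ c : I → ℚ, (∀ i, 0 ≤ c i) ∧ -β = ∑ i, c i • simple i)
  coroot_self : ∀ β ∈ roots, coroot β β = 2
  crystallographic : ∀ β ∈ roots, ∀ γ ∈ roots, ∃ n : ℤ, coroot β γ = n
  posCoeff_spec : ∀ β ∈ roots,
    (∃ c : I → ℚ, (∀ i, 0 ≤ c i) ∧ β = ∑ i, c i • simple i) →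
    β = ∑ i, (posCoeff β i : ℚ) • simple i
  srefl_apply : ∀ β ∈ roots, ∀ v : V, act (srefl β) v = v - coroot β v • β
  act_faithful : ∀ g : W, (∀ v : V, act g v = v) → g = 1
  roots_invariant : ∀ g : W, ∀ β ∈ roots, act g β ∈ roots
  coroot_equivariant : ∀ g : W, ∀ β ∈ roots, ∀ v : V,
    coroot (act g β) (act g v) = coroot β v
  generated : ∀ g : W, ∃ l : List I, g = (l.map fun i => srefl (simple i)).prod

namespace WeylSetting

attribute [instance] fintypeI decEqI acg mod grp

variable (D : WeylSetting)

/-- the simple reflection attached to a node of the Dynkin diagram -/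
def s (i : D.I) : D.W := D.srefl (D.simple i)

/-- the product `s_{i_1} ⋯ s_{i_r}` of the simple reflections listed in `l` -/
def wordProd (l : List D.I) : D.W := (l.map D.s).prod

/-- `β` is a positive root: a root which is a nonnegative combination of simple roots -/
def IsPosRoot (β : D.V) : Prop :=
  β ∈ D.roots ∧ ∃ c : D.I → ℚ, (∀ i, 0 ≤ c i) ∧ β = ∑ i, c i • D.simple i

/-- the length of a Weyl group element -/
noncomputable def length (g : D.W) : ℕ :=
  sInf {n | ∃ l : List D.I, l.length = n ∧ D.wordProd l = g}

/-- `l` is a reduced word for `g` -/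
def IsReduced (l : List D.I) (g : D.W) : Prop :=
  D.wordProd l = g ∧ l.length = D.length g

/-- the number of reduced words of `g` -/
noncomputable def RedCard (g : D.W) : ℕ := Nat.card {l : List D.I // D.IsReduced l g}

/-- the (strong) Bruhat order on the Weyl group -/
def bruhatLE : D.W → D.W → Prop :=
  Relation.ReflTransGen
    (fun a b => (∃ β, D.IsPosRoot β ∧ b = D.srefl β * a) ∧ D.length a < D.length b)

/-- strict (strong) Bruhat order -/
def bruhatLT (a b : D.W) : Prop := D.bruhatLE a b ∧ a ≠ b

/-- the left weak Bruhat order: `a ≤_L b` iff `ℓ(b a⁻¹) + ℓ(a) = ℓ(b)` -/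
def weakLE (a b : D.W) : Prop := D.length (b * a⁻¹) + D.length a = D.length b

/-- the height of a positive root: the sum of its coefficients in the simple roots -/
noncomputable def ht (β : D.V) : ℕ := ∑ i, D.posCoeff β i

/-- an integral weight: the pairings with all positive coroots are integers -/
def IsIntegral (lam : D.V) : Prop :=
  ∀ β, D.IsPosRoot β → ∃ n : ℤ, D.coroot β lam = n

/-- a dominant integral weight -/
def IsDominant (lam : D.V) : Prop :=
  D.IsIntegral lam ∧ ∀ i, 0 ≤ D.coroot (D.simple i) lam

/-- a pre-dominant integral weight: `⟨λ, β∨⟩ ≥ -1` for all positive roots `β` -/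
def IsPreDominant (lam : D.V) : Prop :=
  D.IsIntegral lam ∧ ∀ β, D.IsPosRoot β → -1 ≤ D.coroot β lam

/-- the diagram `D(λ) = {β ∈ R⁺ : ⟨λ, β∨⟩ = -1}` of a pre-dominant weight -/
noncomputable def diagram (lam : D.V) : Finset D.V :=
  D.roots.filter fun β => D.IsPosRoot β ∧ D.coroot β lam = -1

/-- `IsWeightPath λ [β₁, …, β_r]` says that
`λ = λ₀ →β₁ λ₁ →β₂ ⋯ →β_r λ_r` is a `λ`-path, i.e. each `β_j` is a positive
root, `⟨λ_{j-1}, β_j∨⟩ = -1` and `λ_j = s_{β_j}(λ_{j-1})`. -/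
def IsWeightPath : D.V → List D.V → Prop
  | _, [] => True
  | lam, β :: rest =>
      D.IsPosRoot β ∧ D.coroot β lam = -1 ∧
        IsWeightPath (D.act (D.srefl β) lam) rest

/-- the term `1/β₁ ⋅ 1/(β₁+β₂) ⋅ … ⋅ 1/(β₁+⋯+β_r)` attached to a path
`(β₁, …, β_r)`, computed in a field `F` via a linear embedding `emb`. -/
noncomputable def pathTerm {F : Type} [Field F] [Algebra ℚ F]
    (emb : D.V →ₗ[ℚ] F) (l : List D.V) : F :=
  ∏ j ∈ Finset.range l.length, (emb ((l.take (j + 1)).sum))⁻¹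

/-- `w` is a π-minuscule element (in the sense of Peterson). -/
def IsMinuscule (pi : D.V) (w : D.W) : Prop :=
  ∃ l : List D.I, D.IsReduced l w ∧
    ∀ k : Fin l.length,
      D.coroot (D.simple (l.get k)) (D.act (D.wordProd (l.drop (k.val + 1))) pi) = 1

/-- the stabilizer `W_π = Stab_W(π)` of a weight -/
def stab (pi : D.V) : Subgroup D.W where
  carrier := {g | D.act g pi = pi}
  one_mem' := by simp
  mul_mem' := by
    intro a b ha hb
    simp only [Set.mem_setOf_eq] at *
    calc D.act (a * b) pi = D.act a (D.act b pi) := by rw [map_mul]; rfl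
    _ = pi := by rw [hb, ha]
  inv_mem' := by
    intro a ha
    simp only [Set.mem_setOf_eq] at *
    calc D.act a⁻¹ pi = D.act a⁻¹ (D.act a pi) := by rw [ha]
    _ = D.act (a⁻¹ * a) pi := by rw [map_mul]; rfl
    _ = pi := by simp

/-- `u` is the minimal-length representative of its coset `uH` -/
def IsMinRep (H : Subgroup D.W) (u : D.W) : Prop :=
  ∀ g : D.W, u⁻¹ * g ∈ H → D.length u ≤ D.length g

/-- `a` and `b` lie in the same coset of `H`, i.e. `aH = bH` -/
def SameCoset (H : Subgroup D.W) (a b : D.W) : Prop := a⁻¹ * b ∈ H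

/-- `u →β w` in `W^P`: `β` is a positive root, `u, w` are minimal-length
representatives, `s_β w H = u H`, and `u < w` in Bruhat order -/
def Arrow (H : Subgroup D.W) (u w : D.W) (β : D.V) : Prop :=
  D.IsPosRoot β ∧ D.IsMinRep H u ∧ D.IsMinRep H w ∧
    D.SameCoset H (D.srefl β * w) u ∧ D.bruhatLT u w

/-- `ArrowPath H w [β₁, …, β_r]` encodes a directed path
`x_r →β_r ⋯ → x_1 →β₁ x_0 = w` in the Bruhat graph on `W^P`. -/
def ArrowPath (H : Subgroup D.W) : D.W → List D.V → Prop
  | _, [] => True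
  | w, β :: rest => ∃ u, D.Arrow H u w β ∧ ArrowPath H u rest

/-- directed paths as above whose vertices all lie above `v` in Bruhat order -/
def ArrowPathGE (H : Subgroup D.W) (v : D.W) : D.W → List D.V → Prop
  | _, [] => True
  | w, β :: rest => ∃ u, D.Arrow H u w β ∧ D.bruhatLE v u ∧ ArrowPathGE H v u rest

/-- directed paths from `u` to `w`:
`u = x_r →β_r ⋯ → x_1 →β₁ x_0 = w` encoded by the list `[β₁, …, β_r]`. -/
def ArrowPathFromTo (H : Subgroup D.W) (u : D.W) : D.W → List D.V → Prop
  | w, [] => u = w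
  | w, β :: rest => ∃ x, D.Arrow H x w β ∧ ArrowPathFromTo H u x rest

/-- `S(w) = {β ∈ R⁺ : s_β w < w}` -/
noncomputable def Sset (w : D.W) : Finset D.V :=
  D.roots.filter fun β => D.IsPosRoot β ∧ D.bruhatLT (D.srefl β * w) w

/-- `S(w/v) = {β ∈ R⁺ : v ≤ s_β w < w}` -/
noncomputable def SsetSkew (v w : D.W) : Finset D.V :=
  D.roots.filter fun β =>
    D.IsPosRoot β ∧ D.bruhatLE v (D.srefl β * w) ∧ D.bruhatLT (D.srefl β * w) w

/-- an oriented edge `x → y` in the Bruhat graph of `G/P`: `x, y` are minimal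
representatives, `xH < yH`, and `yH = x s_γ H` for some positive root `γ` -/
def GEdge (H : Subgroup D.W) (x y : D.W) : Prop :=
  D.IsMinRep H x ∧ D.IsMinRep H y ∧ D.bruhatLT x y ∧
    ∃ γ, D.IsPosRoot γ ∧ D.SameCoset H (x * D.srefl γ) y

/-- the (unique) positive root `γ` with `yH = x s_γ H` attached to an edge -/
noncomputable def edgeRoot (H : Subgroup D.W) (x y : D.W) : D.V :=
  if h : ∃ γ, D.IsPosRoot γ ∧ D.SameCoset H (x * D.srefl γ) y then h.choose else 0

/-- `GChainTo H v t [x₁, …, x_r]` encodes a directed path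
`v ≤ x_r → ⋯ → x_1 → x_0 = t` in the Bruhat graph of `G/P` -/
def GChainTo (H : Subgroup D.W) (v : D.W) : D.W → List D.W → Prop
  | _, [] => True
  | t, x :: rest => D.GEdge H x t ∧ D.bruhatLE v x ∧ GChainTo H v x rest

/-- the weighted term
`(m_Λ(x_r,x_{r-1})/W_Λ(x_r)) ⋯ (m_Λ(x_1,x_0)/W_Λ(x_1))` of a path in the
`Λ`-Bruhat graph, computed in a field `F` via a linear embedding `emb`. -/
noncomputable def chainTerm {F : Type} [Field F] [Algebra ℚ F]
    (emb : D.V →ₗ[ℚ] F) (H : Subgroup D.W) (Lam : D.W → D.V) (w : D.W) :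
    D.W → List D.W → F
  | _, [] => 1
  | t, x :: rest =>
      algebraMap ℚ F (D.coroot (D.edgeRoot H x t) (Lam x)) *
        (emb (D.act x (Lam x) - D.act w (Lam x)))⁻¹ *
        chainTerm emb H Lam w x rest

/-- the Bruhat order on cosets: `aH ≤ bH` -/
def cosetLE (H : Subgroup D.W) (a b : D.W) : Prop :=
  ∃ x y, D.SameCoset H a x ∧ D.SameCoset H b y ∧ D.bruhatLE x y

/-- the (standard) parabolic subgroup generated by simple reflections in `J` -/
def parab (J : Set D.I) : Subgroup D.W := Subgroup.closure (D.s '' J)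

/-- `X*(T)_P`: integral weights orthogonal to all coroots of `W_P`,
i.e. to `γ∨` for all positive roots `γ` in the span of the simple roots of `P` -/
def OrthWeightP (J : Set D.I) (lam : D.V) : Prop :=
  D.IsIntegral lam ∧
    ∀ γ, D.IsPosRoot γ → γ ∈ Submodule.span ℚ (D.simple '' J) → D.coroot γ lam = 0

/-- an admissible function `Λ : [v,w]^P → X*(T)_P` -/
def Admissible (J : Set D.I) (v w : D.W) (Lam : D.W → D.V) : Prop :=
  (∀ x, D.IsMinRep (D.parab J) x → D.bruhatLE v x → D.bruhatLE x w →
      D.OrthWeightP J (Lam x)) ∧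
  (∀ x, D.IsMinRep (D.parab J) x → D.bruhatLE v x → D.bruhatLE x w → x ≠ w →
      D.act x (Lam x) ≠ D.act w (Lam x))

/-- the subword of `l` with letters at the positions in `S`, in increasing order -/
def subwordF (l : List D.I) (S : Finset (Fin l.length)) : List D.I :=
  ((List.finRange l.length).filter fun j => j ∈ S).map l.get

/-- `β_j = s_{i_1} ⋯ s_{i_{j-1}}(α_{i_j})` attached to a reduced word `l` -/
noncomputable def refRoot (l : List D.I) (j : Fin l.length) : D.V :=
  D.act (D.wordProd (l.take j.val)) (D.simple (l.get j))

/-- the Weyl group is simply laced: the Cartan pairing is symmetric -/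
def SimplyLaced : Prop :=
  ∀ i j, D.coroot (D.simple i) (D.simple j) = D.coroot (D.simple j) (D.simple i)

/-- generating relation of the heap order of the word `l`:
`p_j < p_k` whenever `j < k` and `s_{i_j}`, `s_{i_k}` do not commute -/
def heapCovers (l : List D.I) (j k : Fin l.length) : Prop :=
  (j : ℕ) < (k : ℕ) ∧ D.s (l.get j) * D.s (l.get k) ≠ D.s (l.get k) * D.s (l.get j)

/-- the heap order of the word `l`: the minimal partial order generated by
`heapCovers` -/
def heapLE (l : List D.I) : Fin l.length → Fin l.length → Prop :=
  Relation.ReflTransGen (D.heapCovers l)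

/-- strict heap order -/
def heapLT (l : List D.I) (j k : Fin l.length) : Prop := D.heapLE l j k ∧ j ≠ k

/-- `F` is an order filter of the heap `H(w)` of the word `l` -/
def IsHeapFilter (l : List D.I) (F : Finset (Fin l.length)) : Prop :=
  ∀ j k, j ∈ F → D.heapLE l j k → k ∈ F

/-- `i` and `j` are joined by an edge of the Dynkin diagram -/
def adjDynkin (i j : D.I) : Prop := i ≠ j ∧ D.s i * D.s j ≠ D.s j * D.s i

/-- an elementary excitation `A ▷ B` of subsets of the heap of the word `l` -/
def Excite (l : List D.I) (A B : Finset (Fin l.length)) : Prop :=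
  ∃ p q, D.heapLT l p q ∧ l.get p = l.get q ∧ q ∈ A ∧ p ∈ B ∧
    A.erase q = B.erase p ∧
    (∀ z, D.heapLT l p z → D.heapLT l z q → l.get z ≠ l.get p) ∧
    ∀ u ∈ A, D.heapLE l p u → D.heapLE l u q → ¬ D.adjDynkin (l.get p) (l.get u)

/-- `A` is an excited diagram of `F` in the heap of the word `l`,
i.e. `A ∈ E_{H(w)}(F)` -/
def InExcited (l : List D.I) (F A : Finset (Fin l.length)) : Prop :=
  Relation.ReflTransGen (D.Excite l) F A

end WeylSetting
namespace WeylSetting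

variable (D : WeylSetting)

/-- pairing with a simple coroot -/
noncomputable def pr (i : D.I) (v : D.V) : ℚ := D.coroot (D.simple i) v

theorem act_mul (g h : D.W) (v : D.V) : D.act (g * h) v = D.act g (D.act h v) := by
  rw [map_mul]; rfl

theorem act_one (v : D.V) : D.act 1 v = v := by
  rw [map_one]; rfl

theorem act_inv_act (g : D.W) (v : D.V) : D.act g⁻¹ (D.act g v) = v := by
  rw [← act_mul, inv_mul_cancel, act_one]

theorem act_act_inv (g : D.W) (v : D.V) : D.act g (D.act g⁻¹ v) = v := by
  rw [← act_mul, mul_inv_cancel, act_one]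

theorem act_ext (g h : D.W) (H : ∀ v, D.act g v = D.act h v) : g = h := by
  have := D.act_faithful (h⁻¹ * g) (fun v => by rw [act_mul, H, act_inv_act])
  exact (inv_mul_eq_one.mp this).symm

theorem act_s (i : D.I) (v : D.V) : D.act (D.s i) v = v - D.pr i v • D.simple i :=
  D.srefl_apply _ (D.simple_mem i) v

theorem pr_self (i : D.I) : D.pr i (D.simple i) = 2 := D.coroot_self _ (D.simple_mem i)

theorem pr_sub (i : D.I) (v u : D.V) : D.pr i (v - u) = D.pr i v - D.pr i u := by
  simp [pr]

theorem pr_add (i : D.I) (v u : D.V) : D.pr i (v + u) = D.pr i v + D.pr i u := by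
  simp [pr]

theorem exists_coord : ∃ e : D.I → (D.V →ₗ[ℚ] ℚ), ∀ i j,
    e i (D.simple j) = if i = j then 1 else 0 := by
  have hk : LinearMap.ker (Fintype.linearCombination ℚ D.simple) = ⊥ :=
    LinearMap.ker_eq_bot.mpr D.simple_indep.fintypeLinearCombination_injective
  obtain ⟨g, hg⟩ := LinearMap.exists_leftInverse_of_injective _ hk
  refine ⟨fun i => (LinearMap.proj i).comp g, fun i j => ?_⟩
  have := congrArg (fun F => F (Pi.single j (1:ℚ)) i) hg
  simp [Fintype.linearCombination_apply, Pi.single_apply] at this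
  simpa using this

/-- coordinate functionals -/
noncomputable def crd : D.I → (D.V →ₗ[ℚ] ℚ) := D.exists_coord.choose

theorem crd_simple (i j : D.I) : D.crd i (D.simple j) = if i = j then 1 else 0 :=
  D.exists_coord.choose_spec i j

theorem crd_sum (i : D.I) (c : D.I → ℚ) : D.crd i (∑ j, c j • D.simple j) = c i := by
  simp [crd_simple]

/-- height functional -/
noncomputable def htf : D.V →ₗ[ℚ] ℚ := ∑ i, D.crd i

theorem htf_simple (j : D.I) : D.htf (D.simple j) = 1 := by
  simp [htf, crd_simple]

theorem htf_pos (β : D.V) (h : D.IsPosRoot β) : D.htf β = D.ht β := by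
  have := D.posCoeff_spec β h.1 h.2
  conv_lhs => rw [this]
  simp [htf_simple, ht]

theorem isPos_simple (i : D.I) : D.IsPosRoot (D.simple i) :=
  ⟨D.simple_mem i, fun j => if j = i then 1 else 0,
    fun j => by dsimp only; split_ifs <;> norm_num, by simp⟩

theorem isPos_crd {β : D.V} (h : D.IsPosRoot β) (i : D.I) : 0 ≤ D.crd i β := by
  obtain ⟨_, c, hc, rfl⟩ := h
  rw [crd_sum]; exact hc i

theorem root_ne_zero {β : D.V} (h : β ∈ D.roots) : β ≠ 0 := by
  rintro rfl
  have := D.coroot_self 0 h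
  simp at this

/-- a root that has a positive coordinate is positive -/
theorem isPos_of_crd {β : D.V} (h : β ∈ D.roots) (i : D.I) (hi : 0 < D.crd i β) :
    D.IsPosRoot β := by
  rcases D.root_pos_or_neg β h with h' | ⟨c, hc, h'⟩
  · exact ⟨h, h'⟩
  · have := congrArg (D.crd i) h'
    rw [crd_sum, map_neg] at this
    linarith [hc i]

theorem isPos_eq {β : D.V} (h : D.IsPosRoot β) : β = ∑ i, D.crd i β • D.simple i := by
  obtain ⟨_, c, hc, rfl⟩ := h
  simp only [crd_sum]

theorem not_isPos_neg {β : D.V} (h : D.IsPosRoot β) : ¬ D.IsPosRoot (-β) := by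
  intro h'
  apply D.root_ne_zero h.1
  rw [D.isPos_eq h]
  refine Finset.sum_eq_zero fun i _ => ?_
  have h1 := D.isPos_crd h i
  have h2 := D.isPos_crd h' i
  rw [map_neg] at h2
  rw [show D.crd i β = 0 by linarith, zero_smul]

theorem isPos_neg_of_not {β : D.V} (h : β ∈ D.roots) (hn : ¬ D.IsPosRoot β) :
    D.IsPosRoot (-β) := by
  rcases D.root_pos_or_neg β h with h' | h'
  · exact absurd ⟨h, h'⟩ hn
  · exact ⟨D.roots_neg _ h, h'⟩

theorem pr_simple_nonpos {i j : D.I} (hij : i ≠ j) : D.pr i (D.simple j) ≤ 0 := by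
  have hr := D.roots_invariant (D.s i) _ (D.simple_mem j)
  rw [act_s] at hr
  have hp := D.isPos_of_crd hr j (by simp [crd_simple, hij.symm])
  have := D.isPos_crd hp i
  simp [crd_simple, hij] at this
  exact this

theorem pr_simple_symm {i j : D.I} (h : D.pr i (D.simple j) = 0) :
    D.pr j (D.simple i) = 0 := by
  by_cases hij : i = j
  · subst hij; exact h
  by_contra hne
  have hlt : D.pr j (D.simple i) < 0 :=
    lt_of_le_of_ne (D.pr_simple_nonpos (Ne.symm hij)) hne
  have hr := D.roots_invariant (D.s i) _ (D.roots_invariant (D.s j) _ (D.simple_mem i))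
  have e : D.act (D.s i) (D.act (D.s j) (D.simple i)) =
      - D.simple i - D.pr j (D.simple i) • D.simple j := by
    rw [act_s D j, map_sub, map_smul, act_s, act_s, h, pr_self]
    module
  rw [e] at hr
  have hp := D.isPos_of_crd hr j (by simp [crd_simple, Ne.symm hij]; exact hlt)
  have := D.isPos_crd hp i
  simp [crd_simple, hij] at this
  linarith

theorem s_mul_self (i : D.I) : D.s i * D.s i = 1 := by
  apply D.act_ext
  intro v
  rw [act_mul, act_one, act_s, act_s, pr_sub]
  have : D.pr i (D.pr i v • D.simple i) = D.pr i v * 2 := by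
    rw [← pr_self D i]; simp [pr]
  rw [this]
  module

theorem s_inv (i : D.I) : (D.s i)⁻¹ = D.s i :=
  inv_eq_of_mul_eq_one_right (D.s_mul_self i)

theorem s_comm {i j : D.I} (h : D.pr i (D.simple j) = 0) :
    D.s i * D.s j = D.s j * D.s i := by
  have h' := D.pr_simple_symm h
  apply D.act_ext
  intro v
  rw [act_mul, act_mul, act_s D j, act_s D i v, map_sub, map_sub, map_smul, map_smul,
    act_s, act_s, act_s, act_s, h, h']
  module

/-! ### Minuscule paths (letters listed in the order in which they are applied) -/

/-- `Pt μ l lam`: minuscule path from `μ` down to `lam` -/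
def Pt : D.V → List D.I → D.V → Prop
  | μ, [], lam => μ = lam
  | μ, i :: l, lam => D.pr i μ = 1 ∧ Pt (μ - D.simple i) l lam

theorem Pt_append (μ lam : D.V) (l l' : List D.I) :
    D.Pt μ (l ++ l') lam ↔ ∃ κ, D.Pt μ l κ ∧ D.Pt κ l' lam := by
  induction l generalizing μ with
  | nil => simp [Pt]
  | cons i l ih =>
    simp only [List.cons_append, Pt, ih]
    constructor
    · rintro ⟨h, κ, h1, h2⟩; exact ⟨κ, ⟨h, h1⟩, h2⟩
    · rintro ⟨κ, ⟨h, h1⟩, h2⟩; exact ⟨h, κ, h1, h2⟩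

theorem Pt_crd {μ lam : D.V} {l : List D.I} (h : D.Pt μ l lam) (k : D.I) :
    D.crd k μ - D.crd k lam = l.count k := by
  induction l generalizing μ with
  | nil => have : μ = lam := h
           simp [this]
  | cons i l ih =>
    have := ih h.2
    rw [map_sub, crd_simple] at this
    rw [List.count_cons]
    by_cases hk : k = i
    · subst hk
      simp at this ⊢; linarith
    · simp [hk, Ne.symm hk] at this ⊢; linarith

theorem Pt_htf {μ lam : D.V} {l : List D.I} (h : D.Pt μ l lam) :
    D.htf μ - D.htf lam = l.length := by
  induction l generalizing μ with
  | nil => have : μ = lam := h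
           simp [this]
  | cons i l ih =>
    have := ih h.2
    rw [map_sub, htf_simple] at this
    push_cast [List.length_cons]
    linarith

theorem Pt_le_one {μ lam : D.V} {l : List D.I} (h : D.Pt μ l lam) {i : D.I} (hi : i ∈ l) :
    D.pr i μ ≤ 1 := by
  induction l generalizing μ with
  | nil => simp at hi
  | cons k l ih =>
    by_cases hk : i = k
    · subst hk; exact h.1.le
    · have := ih h.2 (by simpa [hk] using hi)
      rw [pr_sub] at this
      linarith [D.pr_simple_nonpos hk]

theorem Pt_ge {μ lam : D.V} {l : List D.I} (h : D.Pt μ l lam)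
    (hm : ∀ i, -1 ≤ D.pr i μ) (i : D.I) : -1 ≤ D.pr i lam := by
  induction l generalizing μ with
  | nil => have : μ = lam := h
           rw [← this]; exact hm i
  | cons k l ih =>
    refine ih h.2 fun j => ?_
    rw [pr_sub]
    by_cases hk : j = k
    · subst hk; rw [h.1, pr_self]; norm_num
    · linarith [D.pr_simple_nonpos hk, hm j]

/-- Product of the reflections in a path -/
def qp : List D.I → D.W
  | [] => 1
  | i :: l => qp l * D.s i

theorem qp_eq (l : List D.I) : D.qp l = D.wordProd l.reverse := by
  induction l with
  | nil => simp [qp, wordProd]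
  | cons i l ih => simp [qp, ih, wordProd]

theorem Pt_pull {μ lam : D.V} {l : List D.I} (h : D.Pt μ l lam) {i : D.I} (hi : i ∈ l)
    (h1 : D.pr i μ = 1) :
    ∃ l', D.Pt (μ - D.simple i) l' lam ∧ D.qp l = D.qp l' * D.s i := by
  induction l generalizing μ with
  | nil => simp at hi
  | cons k l ih =>
    by_cases hk : i = k
    · subst hk; exact ⟨l, h.2, rfl⟩
    · have hil : i ∈ l := by simpa [hk] using hi
      have h2 := D.Pt_le_one h.2 hil
      rw [pr_sub] at h2
      have h0 : D.pr i (D.simple k) = 0 :=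
        le_antisymm (D.pr_simple_nonpos hk) (by linarith)
      have h0' := D.pr_simple_symm h0
      obtain ⟨l', hl', hq⟩ := ih h.2 hil (by rw [pr_sub]; linarith)
      refine ⟨k :: l', ⟨?_, ?_⟩, ?_⟩
      · rw [pr_sub, h.1, h0']; norm_num
      · rwa [sub_right_comm]
      · simp only [qp]
        rw [hq, mul_assoc, D.s_comm h0, mul_assoc]

theorem Pt_unique {μ lam : D.V} {l l' : List D.I} (h : D.Pt μ l lam) (h' : D.Pt μ l' lam) :
    D.qp l = D.qp l' := by
  induction l generalizing μ l' with
  | nil =>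
    have e : μ = lam := h
    subst e
    have := D.Pt_htf h'
    rw [sub_self] at this
    have : l' = [] := List.length_eq_zero_iff.mp (by exact_mod_cast this.symm)
    rw [this]
  | cons k l ih =>
    have hk : k ∈ l' := by
      have h1 := D.Pt_crd h k
      have h2 := D.Pt_crd h' k
      rw [h1] at h2
      have h3 : (k :: l).count k = l'.count k := by exact_mod_cast h2
      apply List.count_pos_iff.mp
      rw [← h3]
      simp
    obtain ⟨l'', hl, hq⟩ := D.Pt_pull h' hk h.1
    rw [hq, qp, ih h.2 hl]

/-! ### The localization function and its Chevalley rule -/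

/-- localization polynomials, evaluated at a functional -/
noncomputable def G (pi : D.V) : List D.I → D.V → (D.V →ₗ[ℚ] ℚ) → ℚ
  | [], μ, _ => if μ = pi then 1 else 0
  | i :: l, μ, f =>
      G pi l μ (f.comp (D.act (D.s i)).toLinearMap) +
        if D.pr i μ = -1 then
          f (D.simple i) * G pi l (μ + D.simple i) (f.comp (D.act (D.s i)).toLinearMap)
        else 0

theorem G_path {pi lam μ : D.V} {l : List D.I} {f : D.V →ₗ[ℚ] ℚ}
    (h : D.Pt pi l.reverse lam) (hG : D.G pi l μ f ≠ 0) :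
    ∃ l1 l2, D.Pt pi l1 μ ∧ D.Pt μ l2 lam := by
  induction l generalizing μ lam f with
  | nil =>
    have e : pi = lam := h
    by_cases hm : μ = pi
    · exact ⟨[], [], hm.symm, hm.trans e⟩
    · simp [G, hm] at hG
  | cons i l ih =>
    rw [List.reverse_cons, Pt_append] at h
    obtain ⟨κ, hκ, hi⟩ := h
    by_cases h0 : D.G pi l μ (f.comp (D.act (D.s i)).toLinearMap) = 0
    · by_cases hp : D.pr i μ = -1
      · have h1 : D.G pi l (μ + D.simple i) (f.comp (D.act (D.s i)).toLinearMap) ≠ 0 := by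
          intro h1
          simp [G, h0, h1] at hG
        obtain ⟨l1, l2, h2, h3⟩ := ih hκ h1
        have hone : D.pr i (μ + D.simple i) = 1 := by
          rw [pr_add, hp, pr_self]; norm_num
        obtain ⟨l', hl', -⟩ := D.Pt_pull (l := l2 ++ [i]) (i := i) (μ := μ + D.simple i) (lam := lam)
          ((D.Pt_append _ _ _ _).mpr ⟨κ, h3, hi⟩) (by simp) hone
        rw [add_sub_cancel_right] at hl'
        refine ⟨l1 ++ [i], l', (D.Pt_append _ _ _ _).mpr ⟨_, h2, hone, ?_⟩, hl'⟩
        simp [Pt]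
      · simp [G, h0, hp] at hG
    · obtain ⟨l1, l2, h1, h2⟩ := ih hκ h0
      exact ⟨l1, l2 ++ [i], h1, (D.Pt_append _ _ _ _).mpr ⟨κ, h2, hi⟩⟩

end WeylSetting
namespace WeylSetting

variable (D : WeylSetting)

/-- all pairings with simple coroots are integers -/
def IntV (μ : D.V) : Prop := ∀ i, ∃ n : ℤ, D.pr i μ = n

theorem pr_simple_int (i j : D.I) : ∃ n : ℤ, D.pr i (D.simple j) = n :=
  D.crystallographic _ (D.simple_mem i) _ (D.simple_mem j)

theorem IntV_add {μ : D.V} (h : D.IntV μ) (j : D.I) : D.IntV (μ + D.simple j) := by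
  intro i
  obtain ⟨n, hn⟩ := h i
  obtain ⟨m, hm⟩ := D.pr_simple_int i j
  exact ⟨n + m, by rw [pr_add, hn, hm]; push_cast; rfl⟩

theorem IntV_sub {μ : D.V} (h : D.IntV μ) (j : D.I) : D.IntV (μ - D.simple j) := by
  intro i
  obtain ⟨n, hn⟩ := h i
  obtain ⟨m, hm⟩ := D.pr_simple_int i j
  exact ⟨n - m, by rw [pr_sub, hn, hm]; push_cast; rfl⟩

/-- combinatorial heart of the Chevalley rule, case of a descent -/
theorem chev_aux1 (E : D.V → ℚ) (i : D.I) (μ : D.V) (hc : D.pr i μ = -1)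
    (Z1 : ∀ ν, E ν ≠ 0 → D.pr i ν ≤ 1) :
    (∑ k, if D.pr k (μ + D.simple i) = 1 then E (μ + D.simple i - D.simple k) else 0) =
      E μ + ∑ k, if D.pr k μ = 1 then
        (if D.pr i (μ - D.simple k) = -1 then E (μ - D.simple k + D.simple i) else 0) else 0 := by
  have h1 : E μ = ∑ k, if k = i then E μ else 0 := by simp
  rw [h1, ← Finset.sum_add_distrib]
  refine Finset.sum_congr rfl fun k _ => ?_
  by_cases hk : k = i
  · subst hk
    rw [if_pos (by rw [pr_add, hc, pr_self]; norm_num), if_pos rfl, hc, add_sub_cancel_right]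
    norm_num
  · rw [if_neg hk, zero_add]
    have hik := D.pr_simple_nonpos (Ne.symm hk)
    have hki := D.pr_simple_nonpos hk
    rw [pr_add, pr_sub, hc]
    by_cases h0 : D.pr k (D.simple i) = 0
    · have h0' := D.pr_simple_symm h0
      rw [h0, h0', add_zero]
      simp [sub_add_eq_add_sub]
    · have h0' : D.pr i (D.simple k) ≠ 0 := fun h => h0 (D.pr_simple_symm h)
      have e1 : E (μ + D.simple i - D.simple k) = 0 := by
        by_contra hE
        have := Z1 _ hE
        rw [pr_sub, pr_add, hc, pr_self] at this
        exact h0' (le_antisymm hik (by linarith))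
      rw [e1, if_neg (c := -1 - D.pr i (D.simple k) = -1)
        (fun h => h0' (by linarith))]
      simp

/-- combinatorial heart of the Chevalley rule, case of a non-descent -/
theorem chev_aux2 (E : D.V → ℚ) (i : D.I) (μ : D.V) (hμ : D.IntV μ) (hc : D.pr i μ ≠ -1)
    (Z1 : ∀ ν, E ν ≠ 0 → D.pr i ν ≤ 1) (Z2 : ∀ ν, E ν ≠ 0 → ∀ j, -1 ≤ D.pr j ν) :
    D.pr i μ * E μ = ∑ k, if D.pr k μ = 1 then
        (if D.pr i (μ - D.simple k) = -1 then E (μ - D.simple k + D.simple i) else 0) else 0 := by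
  by_cases h1 : D.pr i μ = 1
  · rw [Finset.sum_eq_single i]
    · rw [if_pos h1, if_pos (by rw [pr_sub, h1, pr_self]; norm_num), h1, one_mul,
        sub_add_cancel]
    · intro k _ hk
      rw [if_neg (c := D.pr i (μ - D.simple k) = -1), ite_self]
      rw [pr_sub, h1]
      intro h
      linarith [D.pr_simple_nonpos (Ne.symm hk)]
    · simp
  · have hL : D.pr i μ * E μ = 0 := by
      by_contra hne
      have hE : E μ ≠ 0 := right_ne_zero_of_mul hne
      have h0 : D.pr i μ ≠ 0 := left_ne_zero_of_mul hne
      have a1 := Z1 _ hE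
      have a2 := Z2 _ hE i
      obtain ⟨n, hn⟩ := hμ i
      rw [hn] at a1 a2 h0 h1 hc
      have b1 : n ≤ 1 := by exact_mod_cast a1
      have b2 : -1 ≤ n := by exact_mod_cast a2
      have b3 : n ≠ 0 := by exact_mod_cast h0
      have b4 : n ≠ 1 := by exact_mod_cast h1
      have b5 : n ≠ -1 := by exact_mod_cast hc
      omega
    rw [hL]
    symm
    refine Finset.sum_eq_zero fun k _ => ?_
    by_cases h2 : D.pr k μ = 1
    · rw [if_pos h2]
      by_cases h3 : D.pr i (μ - D.simple k) = -1
      · rw [if_pos h3]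
        by_contra hE
        have hk : i ≠ k := by rintro rfl; exact h1 h2
        have hik := D.pr_simple_nonpos hk
        have hki := D.pr_simple_nonpos (Ne.symm hk)
        have h4 := Z2 _ hE k
        rw [pr_add, pr_sub, h2, pr_self] at h4
        rw [pr_sub] at h3
        have h5 : D.pr k (D.simple i) = 0 := le_antisymm hki (by linarith)
        have h6 := D.pr_simple_symm h5
        exact hc (by linarith)
      · rw [if_neg h3]
    · rw [if_neg h2]

theorem chevalley {pi lam μ : D.V} {l : List D.I} (f : D.V →ₗ[ℚ] ℚ)
    (hpi : ∀ i, 0 ≤ D.pr i pi) (h : D.Pt pi l.reverse lam) (hμ : D.IntV μ) :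
    (f μ - f lam) * D.G pi l μ f =
      ∑ j, if D.pr j μ = 1 then D.G pi l (μ - D.simple j) f else 0 := by
  induction l generalizing μ lam f with
  | nil =>
    have e : pi = lam := h
    subst e
    rw [Finset.sum_eq_zero]
    · by_cases hm : μ = pi
      · simp [hm]
      · simp [G, hm]
    · intro j _
      by_cases h1 : D.pr j μ = 1
      · rw [if_pos h1]
        simp only [G]
        rw [if_neg]
        intro h2
        have := hpi j
        rw [← h2, pr_sub, h1, pr_self] at this
        norm_num at this
      · rw [if_neg h1]
  | cons i l ih =>
    rw [List.reverse_cons, Pt_append] at h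
    obtain ⟨κ, hκ, hi, hl⟩ := h
    have hl : κ - D.simple i = lam := hl
    set f' := f.comp (D.act (D.s i)).toLinearMap with hf'
    have hfv : ∀ v, f' v = f v - D.pr i v * f (D.simple i) := by
      intro v
      have : f' v = f (D.act (D.s i) v) := rfl
      rw [this, act_s, map_sub, map_smul, smul_eq_mul]
    have hfl : f' κ = f lam := by rw [hfv, hi, ← hl, map_sub, one_mul]
    have Z1 : ∀ ν, D.G pi l ν f' ≠ 0 → D.pr i ν ≤ 1 := by
      intro ν hν
      obtain ⟨l1, l2, h1, h2⟩ := D.G_path hκ hν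
      exact D.Pt_le_one (l := l2 ++ [i]) (lam := lam)
        ((D.Pt_append _ _ _ _).mpr ⟨κ, h2, hi, hl⟩) (by simp)
    have Z2 : ∀ ν, D.G pi l ν f' ≠ 0 → ∀ j, -1 ≤ D.pr j ν := by
      intro ν hν
      obtain ⟨l1, l2, h1, h2⟩ := D.G_path hκ hν
      exact D.Pt_ge h1 (fun j => by linarith [hpi j])
    have ih1 := ih f' hκ hμ
    have ih2 := ih f' hκ (D.IntV_add hμ i)
    rw [hfl, hfv] at ih1 ih2
    have hR : (∑ j, if D.pr j μ = 1 then D.G pi (i :: l) (μ - D.simple j) f else 0) =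
        (∑ j, if D.pr j μ = 1 then D.G pi l (μ - D.simple j) f' else 0) +
        f (D.simple i) * ∑ k, if D.pr k μ = 1 then
        (if D.pr i (μ - D.simple k) = -1 then D.G pi l (μ - D.simple k + D.simple i) f' else 0)
        else 0 := by
      rw [Finset.mul_sum, ← Finset.sum_add_distrib]
      refine Finset.sum_congr rfl fun k _ => ?_
      simp only [G, ← hf']
      split_ifs <;> ring
    rw [hR, ← ih1]
    by_cases hc : D.pr i μ = -1
    · have := D.chev_aux1 (fun ν => D.G pi l ν f') i μ hc Z1
      rw [this] at ih2
      simp only [G, ← hf', if_pos hc]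
      rw [pr_add, pr_self, map_add, hc] at ih2
      rw [hc]
      linear_combination (f (D.simple i)) * ih2
    · have := D.chev_aux2 (fun ν => D.G pi l ν f') i μ hμ hc Z1 Z2
      rw [← this]
      simp only [G, ← hf', if_neg hc]
      ring

theorem G_top {pi : D.V} (hpi : ∀ i, 0 ≤ D.pr i pi) (l : List D.I) (f : D.V →ₗ[ℚ] ℚ) :
    D.G pi l pi f = 1 := by
  induction l generalizing f with
  | nil => simp [G]
  | cons i l ih =>
    simp only [G]
    rw [ih, if_neg (by linarith [hpi i]), add_zero]

/-- the list of inversion roots of a word -/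
noncomputable def rts : List D.I → List D.V
  | [] => []
  | i :: l => D.simple i :: (rts l).map (D.act (D.s i))

theorem G_bot {pi lam : D.V} (l : List D.I) (f : D.V →ₗ[ℚ] ℚ)
    (h : D.Pt pi l.reverse lam) : D.G pi l lam f = ((D.rts l).map f).prod := by
  induction l generalizing f lam with
  | nil =>
    have e : pi = lam := h
    simp [G, rts, e]
  | cons i l ih =>
    rw [List.reverse_cons, Pt_append] at h
    obtain ⟨κ, hκ, hi, hl⟩ := h
    have hl : κ - D.simple i = lam := hl
    have hp : D.pr i lam = -1 := by rw [← hl, pr_sub, hi, pr_self]; norm_num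
    have h0 : D.G pi l lam (f.comp (D.act (D.s i)).toLinearMap) = 0 := by
      by_contra hne
      obtain ⟨l1, l2, h1, h2⟩ := D.G_path hκ hne
      have := D.Pt_htf h2
      rw [← hl, map_sub, htf_simple] at this
      have h3 : (0:ℚ) ≤ l2.length := by positivity
      linarith
    simp only [G, rts]
    rw [h0, if_pos hp, show lam + D.simple i = κ by rw [← hl]; abel, ih _ hκ]
    simp [Function.comp_def]

/-- the finset of minuscule paths of length `n` from `μ` to `lam` -/
noncomputable def paths (lam : D.V) : ℕ → D.V → Finset (List D.I)
  | 0, μ => if μ = lam then {[]} else ∅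
  | n + 1, μ => (Finset.univ.filter fun j => D.pr j μ = 1).biUnion
      fun j => (paths lam n (μ - D.simple j)).image (List.cons j)

theorem mem_paths (lam : D.V) (n : ℕ) (μ : D.V) (l : List D.I) :
    l ∈ D.paths lam n μ ↔ l.length = n ∧ D.Pt μ l lam := by
  induction n generalizing μ l with
  | zero =>
    simp only [paths, List.length_eq_zero_iff]
    split_ifs with h
    · constructor
      · intro h'
        have : l = [] := by simpa using h'
        subst this; exact ⟨rfl, h⟩
      · rintro ⟨rfl, -⟩; simp
    · constructor
      · simp
      · rintro ⟨rfl, h'⟩; exact absurd h' h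
  | succ n ih =>
    simp only [paths, Finset.mem_biUnion, Finset.mem_filter, Finset.mem_univ, true_and,
      Finset.mem_image, ih]
    constructor
    · rintro ⟨j, hj, l', ⟨h1, h2⟩, rfl⟩
      exact ⟨by simp [h1], hj, h2⟩
    · rintro ⟨h1, h2⟩
      cases l with
      | nil => simp at h1
      | cons j l' => exact ⟨j, h2.1, l', ⟨by simpa using h1, h2.2⟩, rfl⟩

theorem card_paths_succ (lam : D.V) (n : ℕ) (μ : D.V) :
    (D.paths lam (n + 1) μ).card =
      ∑ j, if D.pr j μ = 1 then (D.paths lam n (μ - D.simple j)).card else 0 := by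
  rw [paths, Finset.card_biUnion, Finset.sum_filter]
  · refine Finset.sum_congr rfl fun j _ => ?_
    rw [Finset.card_image_of_injective _ (List.cons_injective)]
  · intro j _ k _ hjk
    rw [Function.onFun, Finset.disjoint_left]
    intro l h1 h2
    simp only [Finset.mem_image] at h1 h2
    obtain ⟨a, _, rfl⟩ := h1
    obtain ⟨b, _, hb⟩ := h2
    exact hjk (List.cons.inj hb).1.symm

theorem count_paths {pi lam : D.V} (l : List D.I) (hpi : ∀ i, 0 ≤ D.pr i pi)
    (h : D.Pt pi l.reverse lam) (n : ℕ) (μ : D.V) (hμ : D.IntV μ)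
    (hn : D.htf μ - D.htf lam = n) :
    (n.factorial : ℚ) * D.G pi l μ D.htf =
      (D.paths lam n μ).card * D.G pi l lam D.htf := by
  induction n generalizing μ with
  | zero =>
    simp only [paths]
    split_ifs with hm
    · simp [hm]
    · have : D.G pi l μ D.htf = 0 := by
        by_contra hne
        obtain ⟨l1, l2, h1, h2⟩ := D.G_path h hne
        have h3 := D.Pt_htf h2
        rw [hn] at h3
        have : l2 = [] := List.length_eq_zero_iff.mp (by exact_mod_cast h3.symm)
        subst this
        exact hm h2
      simp [this]
  | succ n ih =>
    have hc := D.chevalley D.htf hpi h hμ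
    rw [hn] at hc
    rw [Nat.factorial_succ, card_paths_succ]
    push_cast at hc ⊢
    rw [mul_comm ((n:ℚ) + 1), mul_assoc, hc, Finset.mul_sum, Finset.sum_mul]
    refine Finset.sum_congr rfl fun j _ => ?_
    split_ifs with hj
    · apply ih _ (D.IntV_sub hμ j)
      rw [map_sub, htf_simple]
      push_cast at hn
      linarith
    · simp

end WeylSetting
namespace WeylSetting

variable (D : WeylSetting)

theorem wordProd_cons (i : D.I) (l : List D.I) :
    D.wordProd (i :: l) = D.s i * D.wordProd l := by simp [wordProd]

theorem wordProd_nil : D.wordProd [] = 1 := by simp [wordProd]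

theorem wordProd_append (l l' : List D.I) :
    D.wordProd (l ++ l') = D.wordProd l * D.wordProd l' := by simp [wordProd]

theorem wordProd_reverse (l : List D.I) : D.wordProd l.reverse = (D.wordProd l)⁻¹ := by
  induction l with
  | nil => simp [wordProd]
  | cons i l ih =>
    rw [List.reverse_cons, wordProd_append, ih, wordProd_cons, wordProd_cons, wordProd_nil,
      mul_inv_rev, s_inv, mul_one]

theorem length_le (l : List D.I) : D.length (D.wordProd l) ≤ l.length :=
  Nat.sInf_le ⟨l, rfl, rfl⟩

theorem exists_red (g : D.W) : ∃ l, D.IsReduced l g := by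
  have hne : {n | ∃ l : List D.I, l.length = n ∧ D.wordProd l = g}.Nonempty := by
    obtain ⟨l, hl⟩ := D.generated g
    exact ⟨l.length, l, rfl, hl.symm⟩
  obtain ⟨l, h1, h2⟩ := Nat.sInf_mem hne
  exact ⟨l, h2, h1⟩

theorem length_mul_le (g h : D.W) : D.length (g * h) ≤ D.length g + D.length h := by
  obtain ⟨l, h1, h2⟩ := D.exists_red g
  obtain ⟨l', h1', h2'⟩ := D.exists_red h
  have := D.length_le (l ++ l')
  rw [wordProd_append, h1, h1', List.length_append, h2, h2'] at this
  exact this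

theorem length_inv_le (g : D.W) : D.length g⁻¹ ≤ D.length g := by
  obtain ⟨l, h1, h2⟩ := D.exists_red g
  have := D.length_le l.reverse
  rw [wordProd_reverse, h1, List.length_reverse, h2] at this
  exact this

/-- the word is reduced -/
def Rd (l : List D.I) : Prop := D.length (D.wordProd l) = l.length

theorem Rd_append {l l' : List D.I} (h : D.Rd (l ++ l')) : D.Rd l ∧ D.Rd l' := by
  unfold Rd at *
  have h1 := D.length_le l
  have h2 := D.length_le l'
  have h3 := D.length_mul_le (D.wordProd l) (D.wordProd l')
  rw [← wordProd_append, h, List.length_append] at h3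
  omega

theorem Rd_reverse {l : List D.I} (h : D.Rd l) : D.Rd l.reverse := by
  unfold Rd at *
  have h1 := D.length_inv_le (D.wordProd l)⁻¹
  rw [inv_inv] at h1
  have h2 := D.length_le l.reverse
  rw [wordProd_reverse, List.length_reverse] at *
  omega

theorem srefl_conj (g : D.W) {β : D.V} (h : β ∈ D.roots) :
    D.srefl (D.act g β) = g * D.srefl β * g⁻¹ := by
  apply D.act_ext
  intro v
  rw [D.srefl_apply _ (D.roots_invariant g β h), act_mul, act_mul, D.srefl_apply β h, map_sub,
    act_act_inv, map_smul]
  have := D.coroot_equivariant g β h (D.act g⁻¹ v)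
  rw [act_act_inv] at this
  rw [this]

theorem coroot_neg {β : D.V} (h : β ∈ D.roots) (v : D.V) :
    D.coroot (-β) v = - D.coroot β v := by
  have h1 := D.coroot_equivariant (D.srefl β) β h v
  have h2 := D.coroot_self _ (D.roots_neg β h)
  have e : D.act (D.srefl β) β = -β := by
    rw [D.srefl_apply β h, D.coroot_self β h]; module
  rw [e, D.srefl_apply β h, map_sub, map_smul, smul_eq_mul] at h1
  rw [map_neg] at h2
  have h3 : D.coroot (-β) β = -2 := by linarith
  rw [h3] at h1
  linarith

theorem srefl_mul_self {β : D.V} (h : β ∈ D.roots) : D.srefl β * D.srefl β = 1 := by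
  apply D.act_ext
  intro v
  rw [act_mul, act_one, D.srefl_apply β h, D.srefl_apply β h, map_sub, map_smul,
    D.coroot_self β h, smul_eq_mul]
  module

/-- proportional roots have proportional coroots -/
theorem coroot_scale {β γ : D.V} {c : ℚ} (hγ : γ ∈ D.roots) (hβ : β ∈ D.roots)
    (h : β = c • γ) (v : D.V) : D.coroot γ v = c * D.coroot β v := by
  have hβ2 : c * D.coroot β γ = 2 := by
    have := D.coroot_self β hβ
    nth_rewrite 2 [h] at this
    simpa using this
  have hγ2 := D.coroot_self γ hγ
  set g := D.srefl β * D.srefl γ with hg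
  have hgv : ∀ v, D.act g v = v - (c * D.coroot β v - D.coroot γ v) • γ := by
    intro v
    rw [hg, act_mul, D.srefl_apply γ hγ, D.srefl_apply β hβ, map_sub, map_smul, smul_eq_mul]
    nth_rewrite 3 [h]
    rw [smul_smul]
    have : (D.coroot β v - D.coroot γ v * D.coroot β γ) * c =
        c * D.coroot β v - D.coroot γ v * 2 := by rw [← hβ2]; ring
    rw [this]
    module
  have hδγ : c * D.coroot β γ - D.coroot γ γ = 0 := by rw [hβ2, hγ2]; norm_num
  have hpow : ∀ (n : ℕ) (v : D.V),
      D.act (g ^ n) v = v - ((n : ℚ) * (c * D.coroot β v - D.coroot γ v)) • γ := by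
    intro n
    induction n with
    | zero => intro v; simp [act_one]
    | succ n ih =>
      intro v
      rw [pow_succ', act_mul, ih, map_sub, map_smul, hgv, hgv γ, hδγ]
      push_cast
      module
  have hroot : ∀ α ∈ D.roots, D.act g α = α := by
    intro α hα
    rw [hgv]
    by_contra hne
    have hδ : c * D.coroot β α - D.coroot γ α ≠ 0 := by
      intro h0; apply hne; rw [h0]; simp
    have hinj : Function.Injective (fun n : ℕ => D.act (g ^ n) α) := by
      intro n m hnm
      simp only [hpow] at hnm
      have h1 := sub_right_injective hnm
      have h2 := smul_left_injective ℚ (D.root_ne_zero hγ) h1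
      have h3 := mul_right_cancel₀ hδ h2
      exact_mod_cast h3
    have : (Set.range fun n : ℕ => D.act (g ^ n) α) ⊆ (D.roots : Set D.V) := by
      rintro _ ⟨n, rfl⟩
      exact D.roots_invariant _ _ hα
    exact Set.infinite_range_of_injective hinj (D.roots.finite_toSet.subset this)
  have h1 := D.coroot_equivariant g γ hγ v
  rw [hroot γ hγ, hgv, map_sub, map_smul, hγ2, smul_eq_mul] at h1
  linarith

theorem srefl_scale {β γ : D.V} {c : ℚ} (hγ : γ ∈ D.roots) (hβ : β ∈ D.roots)
    (h : β = c • γ) : D.srefl β = D.srefl γ := by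
  apply D.act_ext
  intro v
  rw [D.srefl_apply β hβ, D.srefl_apply γ hγ, D.coroot_scale hγ hβ h v]
  nth_rewrite 2 [h]
  rw [smul_smul, mul_comm]

theorem scale_one {c : ℚ} (hc : 0 < c) {j : D.I} (hr : c • D.simple j ∈ D.roots) {v : D.V}
    {e : ℤ} (he : e = 1 ∨ e = -1) (hv : D.pr j v = e) {m : ℤ}
    (hm : D.coroot (c • D.simple j) v = m) : c = 1 := by
  have hp : D.IsPosRoot (c • D.simple j) := D.isPos_of_crd hr j (by simp [crd_simple, hc])
  have h1 := congrArg (D.crd j) (D.posCoeff_spec _ hp.1 hp.2)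
  rw [crd_sum, map_smul, crd_simple, if_pos rfl, smul_eq_mul, mul_one] at h1
  have h2 := D.coroot_scale (D.simple_mem j) hr rfl v
  set n := D.posCoeff (c • D.simple j) j
  rw [hm] at h2
  have h3 : (e : ℚ) = n * m := by rw [← hv, ← h1]; exact h2
  have h4 : e = n * m := by exact_mod_cast h3
  have h5 : (n : ℤ) ∣ 1 := by
    rcases he with rfl | rfl
    · exact ⟨m, h4⟩
    · exact ⟨-m, by linarith⟩
  have h6 : n = 1 := by
    have := Int.natCast_dvd_natCast (m := n) (n := 1)
    exact Nat.dvd_one.mp (this.mp (by simpa using h5))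
  rw [h1, h6]; norm_num

theorem simple_flip {β : D.V} (h : D.IsPosRoot β) {i : D.I}
    (hn : ¬ D.IsPosRoot (D.act (D.s i) β)) : ∃ c : ℚ, 0 < c ∧ β = c • D.simple i := by
  have hr := D.roots_invariant (D.s i) β h.1
  have hz : ∀ j, j ≠ i → D.crd j β = 0 := by
    intro j hj
    by_contra hne
    have hpos : 0 < D.crd j β := lt_of_le_of_ne (D.isPos_crd h j) (Ne.symm hne)
    apply hn
    apply D.isPos_of_crd hr j
    rw [act_s, map_sub, map_smul, crd_simple, if_neg hj]
    simpa using hpos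
  have hβ : β = D.crd i β • D.simple i := by
    conv_lhs => rw [D.isPos_eq h]
    rw [Finset.sum_eq_single i]
    · intro j _ hj; rw [hz j hj, zero_smul]
    · simp
  refine ⟨D.crd i β, lt_of_le_of_ne (D.isPos_crd h i) ?_, hβ⟩
  intro h0
  rw [← h0, zero_smul] at hβ
  exact D.root_ne_zero h.1 hβ

theorem sign_change {β : D.V} (h : D.IsPosRoot β) {l : List D.I}
    (hn : ¬ D.IsPosRoot (D.act (D.wordProd l) β)) :
    ∃ l1 j l2, ∃ c : ℚ, l = l1 ++ j :: l2 ∧ 0 < c ∧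
      D.act (D.wordProd l2) β = c • D.simple j := by
  induction l with
  | nil => rw [wordProd_nil, act_one] at hn; exact absurd h hn
  | cons i l ih =>
    by_cases hp : D.IsPosRoot (D.act (D.wordProd l) β)
    · rw [wordProd_cons, act_mul] at hn
      obtain ⟨c, hc, he⟩ := D.simple_flip hp hn
      exact ⟨[], i, l, c, rfl, hc, he⟩
    · obtain ⟨l1, j, l2, c, rfl, hc, he⟩ := ih hp
      exact ⟨i :: l1, j, l2, c, rfl, hc, he⟩

theorem red_pos {l : List D.I} {i : D.I} (h : D.Rd (l ++ [i])) :
    D.IsPosRoot (D.act (D.wordProd l) (D.simple i)) := by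
  by_contra hn
  obtain ⟨l1, j, l2, c, rfl, hc, he⟩ := D.sign_change (D.isPos_simple i) hn
  have hr := D.roots_invariant (D.wordProd l2) _ (D.simple_mem i)
  have h1 := D.srefl_scale (D.simple_mem j) hr he
  rw [D.srefl_conj _ (D.simple_mem i)] at h1
  have h2 : D.wordProd l2 * D.s i = D.s j * D.wordProd l2 := by
    have : D.s j = D.wordProd l2 * D.s i * (D.wordProd l2)⁻¹ := h1.symm
    rw [this]; group
  have h3 : D.wordProd (l1 ++ j :: l2 ++ [i]) = D.wordProd (l1 ++ l2) := by
    rw [wordProd_append, wordProd_append, wordProd_cons, ← h2, wordProd_cons, wordProd_nil,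
      mul_one, wordProd_append, mul_assoc, mul_assoc, s_mul_self, mul_one]
  have h4 := D.length_le (l1 ++ l2)
  unfold Rd at h
  rw [h3] at h
  simp at h h4
  omega

theorem deletion (l1 l2 : List D.I) (j : D.I) :
    D.srefl (D.act (D.wordProd l1) (D.simple j)) * D.wordProd (l1 ++ j :: l2) =
      D.wordProd (l1 ++ l2) := by
  rw [D.srefl_conj _ (D.simple_mem j), wordProd_append, wordProd_cons, wordProd_append]
  have : D.srefl (D.simple j) = D.s j := rfl
  rw [this]
  calc _ = D.wordProd l1 * (D.s j * D.s j) * D.wordProd l2 := by group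
    _ = _ := by rw [s_mul_self, mul_one]

/-- all steps of the word are minuscule -/
def Mw (pi : D.V) (l : List D.I) : Prop :=
  ∀ l1 j l2, l = l1 ++ j :: l2 → D.pr j (D.act (D.wordProd l2) pi) = 1

theorem Mw_Pt {pi : D.V} {l : List D.I} (h : D.Mw pi l) :
    D.Pt pi l.reverse (D.act (D.wordProd l) pi) := by
  induction l with
  | nil => simp [Pt, wordProd_nil, act_one]
  | cons i l ih =>
    rw [List.reverse_cons, Pt_append]
    have h1 := h [] i l rfl
    refine ⟨_, ih (fun l1 j l2 e => h (i :: l1) j l2 (by rw [e]; rfl)), h1, ?_⟩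
    show _ = _
    rw [wordProd_cons, act_mul, act_s, h1, one_smul]

theorem rts_mem {l : List D.I} {β : D.V} : β ∈ D.rts l ↔
    ∃ l1 j l2, l = l1 ++ j :: l2 ∧ β = D.act (D.wordProd l1) (D.simple j) := by
  induction l generalizing β with
  | nil => simp [rts]
  | cons i l ih =>
    simp only [rts, List.mem_cons, List.mem_map, ih]
    constructor
    · rintro (rfl | ⟨γ, ⟨l1, j, l2, rfl, rfl⟩, rfl⟩)
      · exact ⟨[], i, l, rfl, by rw [wordProd_nil, act_one]⟩
      · exact ⟨i :: l1, j, l2, rfl, by rw [wordProd_cons, act_mul]⟩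
    · rintro ⟨l1, j, l2, h1, rfl⟩
      cases l1 with
      | nil =>
        left
        simp only [List.nil_append, List.cons.injEq] at h1
        rw [wordProd_nil, act_one, h1.1]
      | cons k l1 =>
        right
        simp only [List.cons_append, List.cons.injEq] at h1
        exact ⟨_, ⟨l1, j, l2, h1.2, rfl⟩, by rw [wordProd_cons, act_mul, h1.1]⟩

theorem rts_pos {l : List D.I} (h : D.Rd l) {β : D.V} (hβ : β ∈ D.rts l) : D.IsPosRoot β := by
  obtain ⟨l1, j, l2, rfl, rfl⟩ := D.rts_mem.mp hβ
  apply D.red_pos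
  rw [show l1 ++ j :: l2 = (l1 ++ [j]) ++ l2 by simp] at h
  exact (D.Rd_append h).1

theorem rts_nodup {l : List D.I} (h : D.Rd l) : (D.rts l).Nodup := by
  induction l with
  | nil => simp [rts]
  | cons i l ih =>
    have hl : D.Rd l := (D.Rd_append (l := [i]) (l' := l) h).2
    rw [rts, List.nodup_cons]
    refine ⟨?_, (ih hl).map (D.act (D.s i)).injective⟩
    intro hm
    obtain ⟨β, hβ, he⟩ := List.mem_map.mp hm
    have hp := D.rts_pos hl hβ
    have e : β = - D.simple i := by
      have := congrArg (D.act (D.s i)) he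
      rw [← act_mul, s_mul_self, act_one, act_s, pr_self] at this
      rw [this]; module
    rw [e] at hp
    exact D.not_isPos_neg (D.isPos_simple i) hp

theorem reduced_Mw {pi : D.V} (hIntg : D.IsIntegral pi) {l l' : List D.I} (hM : D.Mw pi l)
    (hl' : D.Rd l') (he : D.wordProd l' = D.wordProd l) : D.Mw pi l' := by
  rintro A i B rfl
  set γ := D.act (D.wordProd B)⁻¹ (D.simple i) with hγ
  have hBγ : D.act (D.wordProd B) γ = D.simple i := by rw [hγ, act_act_inv]
  have hγp : D.IsPosRoot γ := by
    rw [hγ, ← wordProd_reverse]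
    apply D.red_pos
    have := D.Rd_reverse (D.Rd_append hl').2
    rwa [List.reverse_cons] at this
  have hAp : D.IsPosRoot (D.act (D.wordProd A) (D.simple i)) := by
    apply D.red_pos
    rw [show A ++ i :: B = (A ++ [i]) ++ B by simp] at hl'
    exact (D.Rd_append hl').1
  have hneg : ¬ D.IsPosRoot (D.act (D.wordProd l) γ) := by
    rw [← he, wordProd_append, wordProd_cons, act_mul, act_mul, hBγ, act_s, pr_self,
      show D.simple i - (2:ℚ) • D.simple i = - D.simple i by module, map_neg]
    exact D.not_isPos_neg hAp
  obtain ⟨l1, j, l2, c, hl, hc, hcj⟩ := D.sign_change hγp hneg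
  have hj := hM l1 j l2 hl
  obtain ⟨m, hm⟩ := hIntg γ hγp
  have hr := D.roots_invariant (D.wordProd l2) γ hγp.1
  have h1 := D.coroot_equivariant (D.wordProd l2) γ hγp.1 pi
  rw [hcj] at hr h1
  have hc1 := D.scale_one hc hr (e := 1) (Or.inl rfl) (by rw [hj]; norm_num) (h1.trans hm)
  rw [hc1, one_smul] at h1
  have h2 := D.coroot_equivariant (D.wordProd B) γ hγp.1 pi
  rw [hBγ] at h2
  show D.coroot _ _ = 1
  rw [h2, ← h1]
  exact hj

theorem bruhatLT_length {a b : D.W} (h : D.bruhatLT a b) : D.length a < D.length b := by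
  obtain ⟨h1, h2⟩ := h
  have : a = b ∨ D.length a < D.length b := by
    clear h2
    unfold bruhatLE at h1
    induction h1 with
    | refl => exact Or.inl rfl
    | tail hab hbc ih =>
      right
      rcases ih with h | h
      · rw [h]; exact hbc.2
      · exact h.trans hbc.2
  exact this.resolve_left h2

theorem inv_scaled {β : D.V} (hβ : D.IsPosRoot β) {l : List D.I}
    (hn : ¬ D.IsPosRoot (D.act (D.wordProd l)⁻¹ β)) :
    ∃ l1 j l2, ∃ c : ℚ, l = l1 ++ j :: l2 ∧ 0 < c ∧
      D.act (D.wordProd l1)⁻¹ β = c • D.simple j ∧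
      β = c • D.act (D.wordProd l1) (D.simple j) := by
  rw [← wordProd_reverse] at hn
  obtain ⟨m1, j, m2, c, he, hc, h⟩ := D.sign_change hβ hn
  have hl : l = m2.reverse ++ j :: m1.reverse := by
    rw [← List.reverse_reverse l, he]; simp
  have h' : D.act (D.wordProd m2.reverse)⁻¹ β = c • D.simple j := by
    rw [wordProd_reverse, inv_inv, h]
  refine ⟨m2.reverse, j, m1.reverse, c, hl, hc, h', ?_⟩
  rw [← map_smul, ← h', act_act_inv]

theorem Sset_eq {pi : D.V} (hIntg : D.IsIntegral pi) {l : List D.I} (hl : D.Rd l)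
    (hM : D.Mw pi l) : D.Sset (D.wordProd l) = (D.rts l).toFinset := by
  ext β
  simp only [Sset, Finset.mem_filter, List.mem_toFinset]
  constructor
  · rintro ⟨hr, hβ, hlt⟩
    have hlen := D.bruhatLT_length hlt
    by_cases hn : D.IsPosRoot (D.act (D.wordProd l)⁻¹ β)
    · exfalso
      obtain ⟨l', h1, h2⟩ := D.exists_red (D.srefl β * D.wordProd l)
      have hsi : (D.srefl β)⁻¹ = D.srefl β :=
        inv_eq_of_mul_eq_one_right (D.srefl_mul_self hr)
      have hn' : ¬ D.IsPosRoot (D.act (D.wordProd l')⁻¹ β) := by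
        rw [h1, mul_inv_rev, hsi, act_mul, D.srefl_apply β hr, D.coroot_self β hr,
          show β - (2:ℚ) • β = - β by module, map_neg]
        exact D.not_isPos_neg hn
      obtain ⟨l1, j, l2, c, rfl, hc, h3, h4⟩ := D.inv_scaled hβ hn'
      have h5 := D.srefl_scale (D.roots_invariant (D.wordProd l1) _ (D.simple_mem j)) hr h4
      have h6 := D.deletion l1 l2 j
      rw [← h5, h1, ← mul_assoc, D.srefl_mul_self hr, one_mul] at h6
      have h7 := D.length_le (l1 ++ l2)
      rw [← h6] at h7
      simp at h7 h2
      omega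
    · obtain ⟨l1, j, l2, c, hl', hc, h3, h4⟩ := D.inv_scaled hβ hn
      have hj := hM l1 j l2 hl'
      have hnp := D.isPos_neg_of_not (D.roots_invariant _ β hr) hn
      obtain ⟨m, hm⟩ := hIntg _ hnp
      rw [D.coroot_neg (D.roots_invariant _ β hr)] at hm
      have e1 := D.coroot_equivariant (D.wordProd l)⁻¹ β hr (D.act (D.wordProd l) pi)
      rw [act_inv_act] at e1
      have e2 := D.coroot_equivariant (D.wordProd l1)⁻¹ β hr (D.act (D.wordProd l) pi)
      have e3 : D.act (D.wordProd l1)⁻¹ (D.act (D.wordProd l) pi) =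
          D.act (D.s j) (D.act (D.wordProd l2) pi) := by
        rw [hl', wordProd_append, wordProd_cons, act_mul, act_mul, act_inv_act]
      have hr' := D.roots_invariant (D.wordProd l1)⁻¹ β hr
      rw [h3] at hr' e2
      rw [e3] at e2
      have hc1 := D.scale_one hc hr' (v := D.act (D.s j) (D.act (D.wordProd l2) pi))
        (e := -1) (Or.inr rfl)
        (by rw [act_s, hj, one_smul, pr_sub, hj, pr_self]; norm_num)
        (m := -m) (by rw [e2, ← e1]; push_cast; linarith)
      rw [hc1, one_smul] at h4
      exact D.rts_mem.mpr ⟨l1, j, l2, hl', h4⟩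
  · intro hβ
    have hp := D.rts_pos hl hβ
    refine ⟨hp.1, hp, ?_⟩
    obtain ⟨l1, j, l2, rfl, rfl⟩ := D.rts_mem.mp hβ
    have h6 := D.deletion l1 l2 j
    have hlen : D.length (D.srefl (D.act (D.wordProd l1) (D.simple j)) *
        D.wordProd (l1 ++ j :: l2)) < D.length (D.wordProd (l1 ++ j :: l2)) := by
      have h7 := D.length_le (l1 ++ l2)
      rw [h6, hl]
      simp at h7 ⊢
      omega
    refine ⟨Relation.ReflTransGen.single ⟨⟨_, hp, ?_⟩, hlen⟩, ?_⟩
    · rw [← mul_assoc, D.srefl_mul_self hp.1, one_mul]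
    · intro h
      rw [h] at hlen
      exact lt_irrefl _ hlen

theorem minuscule_Mw {pi : D.V} {l : List D.I}
    (h : ∀ k : Fin l.length,
      D.coroot (D.simple (l.get k)) (D.act (D.wordProd (l.drop (k.val + 1))) pi) = 1) :
    D.Mw pi l := by
  rintro l1 j l2 rfl
  have := h ⟨l1.length, by simp⟩
  simpa [pr] using this

theorem redCard_eq {pi : D.V} (hIntg : D.IsIntegral pi) {l : List D.I} (hl : D.Rd l)
    (hM : D.Mw pi l) : D.RedCard (D.wordProd l) =
      (D.paths (D.act (D.wordProd l) pi) l.length pi).card := by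
  unfold RedCard
  rw [← Nat.card_eq_finsetCard]
  refine Nat.card_congr ?_
  have hP := D.Mw_Pt hM
  have key : ∀ m : List D.I, D.IsReduced m (D.wordProd l) ↔
      m.reverse ∈ D.paths (D.act (D.wordProd l) pi) l.length pi := by
    intro m
    rw [mem_paths]
    constructor
    · rintro ⟨h1, h2⟩
      have h3 : D.Rd m := by unfold Rd; rw [h1, h2]
      have h4 := D.Mw_Pt (D.reduced_Mw hIntg hM h3 h1)
      rw [h1] at h4
      exact ⟨by rw [List.length_reverse, h2, hl], h4⟩
    · rintro ⟨h1, h2⟩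
      have h3 := D.Pt_unique h2 hP
      rw [qp_eq, qp_eq, List.reverse_reverse, List.reverse_reverse] at h3
      rw [List.length_reverse] at h1
      exact ⟨h3, by rw [h1, hl]⟩
  exact (List.reverse_involutive.toPerm _).subtypeEquiv key

end WeylSetting

/-- **Peterson's formula.** For a dominant integral weight `π` and a
`π`-minuscule element `w`, the number of reduced expressions of `w` satisfies
`#Red(w) ⋅ ∏_{β ∈ S(w)} ht(β) = ℓ(w)!`. -/
theorem peterson_formula
    (D : WeylSetting) (pi : D.V) (hpi : D.IsDominant pi)
    (w : D.W) (hw : D.IsMinuscule pi w) :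
    D.RedCard w * ∏ β ∈ D.Sset w, D.ht β = (D.length w).factorial := by
  obtain ⟨l, ⟨rfl, hlen⟩, hk⟩ := hw
  have hl : D.Rd l := hlen.symm
  have hM := D.minuscule_Mw hk
  have hP := D.Mw_Pt hM
  have hI : D.IntV pi := fun i => hpi.1 _ (D.isPos_simple i)
  have hht := D.Pt_htf hP
  rw [List.length_reverse] at hht
  have hc := D.count_paths l hpi.2 hP l.length pi hI hht
  rw [D.G_top hpi.2, D.G_bot l _ hP, mul_one] at hc
  rw [D.redCard_eq hpi.1 hl hM, D.Sset_eq hpi.1 hl hM, hl, List.prod_toFinset _ (D.rts_nodup hl)]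
  have he : (D.rts l).map D.htf = (D.rts l).map (fun β => ((D.ht β : ℕ) : ℚ)) :=
    List.map_congr_left fun β hβ => D.htf_pos β (D.rts_pos hl hβ)
  rw [he] at hc
  have : ((D.paths (D.act (D.wordProd l) pi) l.length pi).card *
      ((D.rts l).map D.ht).prod : ℕ) = ((l.length.factorial : ℕ) : ℚ) := by
    rw [hc]
    push_cast
    simp [List.map_map, Function.comp_def]
  exact_mod_cast this
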